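/- The crossover point d_C(N) = ((3N − 2) − √(N² + 12N + 4)) / (4N) is strictly increasing as a function of the number of clients N on the integers N ≥ 4: for all integers 4 ≤ N < M, d_C(N) < d_C(M). -/

import Mathlib

/-- The crossover point of the double- and single-masking cost curves. -/
noncomputable def dC (N : ℕ) : ℝ :=
  ((3 * (N : ℝ) - 2) - Real.sqrt ((N : ℝ) ^ 2 + 12 * N + 4)) / (4 * N)

/-- The crossover point is strictly increasing in the number of clients `N ≥ 4`. -/
theorem flashe_crossover_strictMono (N M : ℕ) (hN : 4 ≤ N) (hNM : N < M) :
    dC N < dC M := by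
  have hn : (0 : ℝ) < N := by exact_mod_cast (by omega : 0 < N)
  have hnm : (N : ℝ) < M := by exact_mod_cast hNM
  have hm : (0 : ℝ) < M := hn.trans hnm
  have key : (N : ℝ) * √((M : ℝ) ^ 2 + 12 * M + 4) < M * √((N : ℝ) ^ 2 + 12 * N + 4) := by
    refine lt_of_pow_lt_pow_left₀ 2 (by positivity) ?_
    rw [mul_pow, mul_pow, Real.sq_sqrt (by positivity), Real.sq_sqrt (by positivity)]
    nlinarith [mul_pos (mul_pos hn hm) (sub_pos.2 hnm), mul_pos (add_pos hn hm) (sub_pos.2 hnm)]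
  unfold dC
  rw [div_lt_div_iff₀ (by positivity) (by positivity)]
  linarith
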